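/- arXiv:2507.11031 — 5 statements merged into one kernel-verified Lean document; each statement's English description precedes it below -/
import Mathlib

section
/- Let Ω be a finite partially ordered set and μ a distribution on Ω with μ(σ) > 0 for all σ ∈ Ω. If ℓ ≥ 1 and P₁, …, P_ℓ, Q₁, …, Q_ℓ ∈ MC_μ satisfy P_i ≼_mc Q_i for every 1 ≤ i ≤ ℓ, then the compositions satisfy P₁P₂⋯P_ℓ ≼_mc Q₁Q₂⋯Q_ℓ. -/
open Finset

/-- A probability distribution on a finite type. -/
def IsDist {Ω : Type*} [Fintype Ω] (μ : Ω → ℝ) : Prop :=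
  (∀ σ, 0 ≤ μ σ) ∧ ∑ σ, μ σ = 1

/-- An increasing (nonnegative) function on a partially ordered set. -/
def Incr {Ω : Type*} [Preorder Ω] (f : Ω → ℝ) : Prop :=
  (∀ x, 0 ≤ f x) ∧ ∀ x y, x ≤ y → f x ≤ f y

/-- Stochastic dominance: `a ≼_sd b` iff `∑ a·f ≤ ∑ b·f` for every increasing
nonnegative `f`. -/
def sd {Ω : Type*} [Fintype Ω] [Preorder Ω] (a b : Ω → ℝ) : Prop :=
  ∀ f : Ω → ℝ, Incr f → ∑ x, a x * f x ≤ ∑ x, b x * f x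

/-- A Markov chain (stochastic matrix) on a finite set. -/
def IsMC {Ω : Type*} [Fintype Ω] (P : Ω → Ω → ℝ) : Prop :=
  (∀ σ τ, 0 ≤ P σ τ) ∧ ∀ σ, ∑ τ, P σ τ = 1

/-- Reversibility of `P` with respect to `μ`. -/
def Reversible {Ω : Type*} (μ : Ω → ℝ) (P : Ω → Ω → ℝ) : Prop :=
  ∀ σ τ, μ σ * P σ τ = μ τ * P τ σ

/-- A Markov chain acting on a function (column vector): `(Pf)(σ) = ∑_τ P(σ,τ) f(τ)`. -/
noncomputable def actF {Ω : Type*} [Fintype Ω] (P : Ω → Ω → ℝ) (f : Ω → ℝ) : Ω → ℝ :=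
  fun σ => ∑ τ, P σ τ * f τ

/-- A Markov chain acting on a distribution (row vector): `(νP)(τ) = ∑_σ ν(σ) P(σ,τ)`. -/
noncomputable def actD {Ω : Type*} [Fintype Ω] (ν : Ω → ℝ) (P : Ω → Ω → ℝ) : Ω → ℝ :=
  fun τ => ∑ σ, ν σ * P σ τ

/-- `P` is stochastically monotone: `Pf` is increasing for every increasing `f`. -/
def StochMono {Ω : Type*} [Fintype Ω] [Preorder Ω] (P : Ω → Ω → ℝ) : Prop :=
  ∀ f : Ω → ℝ, Incr f → Incr (actF P f)

/-- Membership in the family `MC_μ` of Markov chains that are reversible with respect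
to `μ` and stochastically monotone. -/
def MemMC {Ω : Type*} [Fintype Ω] [Preorder Ω] (μ : Ω → ℝ) (P : Ω → Ω → ℝ) : Prop :=
  IsMC P ∧ Reversible μ P ∧ StochMono P

/-- The comparison inequality relation `P ≼_mc Q`: for every distribution `ν` with
`ν/μ` increasing, `νP ≼_sd νQ`. -/
def mcLE {Ω : Type*} [Fintype Ω] [Preorder Ω] (μ : Ω → ℝ) (P Q : Ω → Ω → ℝ) : Prop :=
  ∀ ν : Ω → ℝ, IsDist ν → Incr (fun σ => ν σ / μ σ) → sd (actD ν P) (actD ν Q)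

/-- Matrix (chain) composition: `(PQ)(σ,τ) = ∑_ρ P(σ,ρ) Q(ρ,τ)`. -/
noncomputable def matMul {Ω : Type*} [Fintype Ω] (P Q : Ω → Ω → ℝ) : Ω → Ω → ℝ :=
  fun σ τ => ∑ ρ, P σ ρ * Q ρ τ

/-- The ordered composition `P 0 · P 1 · ⋯ · P (ℓ-1)` of a finite family of chains. -/
noncomputable def chainProd {Ω : Type*} [Fintype Ω] [DecidableEq Ω] {ℓ : ℕ}
    (P : Fin ℓ → Ω → Ω → ℝ) : Ω → Ω → ℝ :=
  (List.ofFn P).foldr matMul (fun σ τ => if σ = τ then 1 else 0)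

theorem sum_actD_mul {Ω : Type*} [Fintype Ω] (ν : Ω → ℝ) (P : Ω → Ω → ℝ) (f : Ω → ℝ) :
    ∑ x, actD ν P x * f x = ∑ x, ν x * actF P f x := by
  simp only [actD, actF, Finset.sum_mul, Finset.mul_sum]
  rw [Finset.sum_comm]
  simp only [mul_assoc]

theorem actD_matMul {Ω : Type*} [Fintype Ω] (ν : Ω → ℝ) (P Q : Ω → Ω → ℝ) :
    actD ν (matMul P Q) = actD (actD ν P) Q := by
  funext τ
  exact (sum_actD_mul ν P fun ρ => Q ρ τ).symm

theorem actF_matMul {Ω : Type*} [Fintype Ω] (P Q : Ω → Ω → ℝ) (f : Ω → ℝ) :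
    actF (matMul P Q) f = actF P (actF Q f) := by
  funext σ
  exact sum_actD_mul (P σ) Q f

theorem IsDist.actD {Ω : Type*} [Fintype Ω] {ν : Ω → ℝ} {P : Ω → Ω → ℝ}
    (hν : IsDist ν) (hP : IsMC P) : IsDist (actD ν P) := by
  refine ⟨fun τ => Finset.sum_nonneg fun σ _ => mul_nonneg (hν.1 σ) (hP.1 σ τ), ?_⟩
  simpa [actF, hP.2, hν.2] using sum_actD_mul ν P fun _ => 1

/-- For a reversible chain, the density of `νP` is `P` applied to the density of `ν`. -/
theorem Reversible.actD_div {Ω : Type*} [Fintype Ω] {μ : Ω → ℝ} {P : Ω → Ω → ℝ}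
    (hP : Reversible μ P) (hpos : ∀ σ, 0 < μ σ) (ν : Ω → ℝ) :
    (fun τ => actD ν P τ / μ τ) = actF P fun σ => ν σ / μ σ := by
  funext τ
  simp only [actD, actF, Finset.sum_div]
  refine Finset.sum_congr rfl fun σ _ => ?_
  have hσ := (hpos σ).ne'
  have hτ := (hpos τ).ne'
  field_simp
  linear_combination ν σ * hP σ τ

theorem StochMono.matMul {Ω : Type*} [Fintype Ω] [Preorder Ω] {P Q : Ω → Ω → ℝ}
    (hP : StochMono P) (hQ : StochMono Q) : StochMono (matMul P Q) := fun f hf => by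
  rw [actF_matMul]
  exact hP _ (hQ f hf)

theorem mcLE.matMul {Ω : Type*} [Fintype Ω] [Preorder Ω] {μ : Ω → ℝ}
    {P Q R S : Ω → Ω → ℝ} (hpos : ∀ σ, 0 < μ σ) (hQ : MemMC μ Q) (hR : StochMono R)
    (hPQ : mcLE μ P Q) (hRS : mcLE μ R S) : mcLE μ (matMul P R) (matMul Q S) := by
  intro ν hν hinc f hf
  have hinc' : Incr fun τ => actD ν Q τ / μ τ := by
    rw [hQ.2.1.actD_div hpos]
    exact hQ.2.2 _ hinc
  rw [actD_matMul, actD_matMul]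
  calc ∑ x, actD (actD ν P) R x * f x = ∑ x, actD ν P x * actF R f x := sum_actD_mul _ _ _
    _ ≤ ∑ x, actD ν Q x * actF R f x := hPQ ν hν hinc _ (hR f hf)
    _ = ∑ x, actD (actD ν Q) R x * f x := (sum_actD_mul _ _ _).symm
    _ ≤ ∑ x, actD (actD ν Q) S x * f x := hRS _ (hν.actD hQ.1) hinc' f hf

theorem chainProd_succ {Ω : Type*} [Fintype Ω] [DecidableEq Ω] {ℓ : ℕ}
    (P : Fin (ℓ + 1) → Ω → Ω → ℝ) :
    chainProd P = matMul (P 0) (chainProd fun i => P i.succ) := by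
  simp [chainProd, List.ofFn_succ]

theorem StochMono.chainProd {Ω : Type*} [Fintype Ω] [DecidableEq Ω] [Preorder Ω] {ℓ : ℕ}
    {P : Fin ℓ → Ω → Ω → ℝ} (hP : ∀ i, StochMono (P i)) : StochMono (chainProd P) := by
  induction ℓ with
  | zero =>
    intro f hf
    have hid : actF (_root_.chainProd P) f = f := by
      funext σ
      simp [actF, _root_.chainProd]
    rwa [hid]
  | succ ℓ ih =>
    rw [chainProd_succ]
    exact (hP 0).matMul (ih fun i => hP i.succ)

theorem mcLE.chainProd {Ω : Type*} [Fintype Ω] [DecidableEq Ω] [Preorder Ω] {μ : Ω → ℝ}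
    (hpos : ∀ σ, 0 < μ σ) {ℓ : ℕ} {P Q : Fin ℓ → Ω → Ω → ℝ}
    (hP : ∀ i, StochMono (P i)) (hQ : ∀ i, MemMC μ (Q i))
    (h : ∀ i, mcLE μ (P i) (Q i)) : mcLE μ (chainProd P) (chainProd Q) := by
  induction ℓ with
  | zero =>
    rw [Subsingleton.elim P Q]
    exact fun _ _ _ _ _ => le_rfl
  | succ ℓ ih =>
    rw [chainProd_succ, chainProd_succ]
    exact mcLE.matMul hpos (hQ 0) (StochMono.chainProd fun i => hP i.succ) (h 0)
      (ih (fun i => hP i.succ) (fun i => hQ i.succ) fun i => h i.succ)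

/-- **Comparison inequalities are preserved by composition**: if `P i ≼_mc Q i` for all
`i`, with all chains in `MC_μ`, then `P₁P₂⋯P_ℓ ≼_mc Q₁Q₂⋯Q_ℓ`. -/
theorem mcLE_composition {Ω : Type*} [Fintype Ω] [DecidableEq Ω] [PartialOrder Ω]
    (μ : Ω → ℝ) (hμ : IsDist μ) (hpos : ∀ σ, 0 < μ σ)
    (ℓ : ℕ) (hℓ : 1 ≤ ℓ) (P Q : Fin ℓ → Ω → Ω → ℝ)
    (hP : ∀ i, MemMC μ (P i)) (hQ : ∀ i, MemMC μ (Q i))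
    (h : ∀ i, mcLE μ (P i) (Q i)) :
    mcLE μ (chainProd P) (chainProd Q) := by
  exact mcLE.chainProd hpos (fun i => (hP i).2.2) hQ h
end

section
/- Let V be a finite set, μ a distribution on {0,1}^V with μ(1_V) > 0, and θ ∈ (0,1). Let P_μ-GD be the Glauber dynamics on μ, let π be the lifted distribution of μ on {0,1,⋆}^V, and let P_π-GD be the Glauber dynamics on π. Let μ^(t) be the distribution after t steps of P_μ-GD started from 1_V, and let π^(t) be the distribution after t steps of P_π-GD started from the law of lift(1_V). Then for every integer t ≥ 0: (a) π^(t) equals the push-forward of μ^(t) under the lift kernel L, i.e., π^(t)(σ) = μ^(t)(contr(σ))·θ^{C_1(σ)}·(1−θ)^{C_⋆(σ)} for all σ; and (b) the push-forward of π^(t) under contr equals μ^(t). -/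
open Finset

attribute [local instance] Classical.propDecidable

/-- The contracting map `{0,1,⋆}^V → {0,1}^V` (with `⋆` encoded as `2 : Fin 3`),
sending `0` to `0` and both `1` and `⋆` to `1`, coordinatewise. -/
def contr {V : Type*} (σ : V → Fin 3) : V → Bool :=
  fun v => if σ v = 0 then false else true

/-- The number of coordinates of `σ ∈ {0,1,⋆}^V` equal to `1`. -/
def C1 {V : Type*} [Fintype V] (σ : V → Fin 3) : ℕ :=
  (univ.filter (fun v => σ v = 1)).card

/-- The number of coordinates of `σ ∈ {0,1,⋆}^V` equal to `⋆` (encoded as `2`). -/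
def Cstar {V : Type*} [Fintype V] (σ : V → Fin 3) : ℕ :=
  (univ.filter (fun v => σ v = 2)).card

/-- The single-coordinate lifting probabilities: `0 ↦ 0` with probability 1,
`1 ↦ 1` with probability `θ` and `1 ↦ ⋆` with probability `1-θ`. -/
noncomputable def liftCoord (θ : ℝ) (b : Bool) (y : Fin 3) : ℝ :=
  if b = false ∧ y = 0 then 1
  else if b = true ∧ y = 1 then θ
  else if b = true ∧ y = 2 then 1 - θ
  else 0

/-- The lift kernel `L(X,Y) = ∏_v ℓ(X_v, Y_v)` from `{0,1}^V` to `{0,1,⋆}^V`. -/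
noncomputable def liftKernel {V : Type*} [Fintype V] (θ : ℝ) (X : V → Bool)
    (Y : V → Fin 3) : ℝ :=
  ∏ v, liftCoord θ (X v) (Y v)

/-- The lifted distribution `π` on `{0,1,⋆}^V` of a distribution `μ` on `{0,1}^V`:
`π(σ) = μ(contr σ) · θ^{C₁(σ)} · (1-θ)^{C_⋆(σ)}`. -/
noncomputable def liftedDist {V : Type*} [Fintype V] (μ : (V → Bool) → ℝ) (θ : ℝ) :
    (V → Fin 3) → ℝ :=
  fun σ => μ (contr σ) * θ ^ C1 σ * (1 - θ) ^ Cstar σ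

/-- One step of a Markov chain acting on a distribution (row vector). -/
noncomputable def stepDist {Ω : Type*} [Fintype Ω] (P : Ω → Ω → ℝ) (ν : Ω → ℝ) : Ω → ℝ :=
  fun τ => ∑ σ, ν σ * P σ τ

/-- The distribution after `t` steps of the chain `P` started from the distribution `ν`. -/
noncomputable def iterDist {Ω : Type*} [Fintype Ω] (P : Ω → Ω → ℝ) (ν : Ω → ℝ) (t : ℕ) :
    Ω → ℝ :=
  (stepDist P)^[t] ν

/-- The Dirac distribution at `x`. -/
noncomputable def delta {Ω : Type*} [DecidableEq Ω] (x : Ω) : Ω → ℝ :=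
  fun σ => if σ = x then 1 else 0

/-- The transition matrix of the Glauber dynamics for a distribution `ν` on `V → S`. -/
noncomputable def glauber {V : Type*} [Fintype V] [DecidableEq V] {S : Type*} [Fintype S]
    (ν : (V → S) → ℝ) (σ τ : V → S) : ℝ :=
  (Fintype.card V : ℝ)⁻¹ *
    ∑ v : V, if ∀ w, w ≠ v → σ w = τ w
      then ν τ / ∑ s : S, ν (Function.update σ v s) else 0

/-- The weight `θ ^ C₁(σ) * (1 - θ) ^ C_⋆(σ)` is the lift probability from `contr σ`. -/
theorem liftKernel_contr {V : Type*} [Fintype V] (θ : ℝ) (σ : V → Fin 3) :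
    liftKernel θ (contr σ) σ = θ ^ C1 σ * (1 - θ) ^ Cstar σ := by
  simp only [liftKernel, C1, Cstar, ← prod_const, prod_filter, ← prod_mul_distrib]
  refine prod_congr rfl fun v _ => ?_
  generalize h : σ v = s
  fin_cases s <;> simp [liftCoord, contr, h]

theorem liftKernel_eq_zero {V : Type*} [Fintype V] (θ : ℝ) {X : V → Bool} {σ : V → Fin 3}
    (h : contr σ ≠ X) : liftKernel θ X σ = 0 := by
  obtain ⟨v, hv⟩ := Function.ne_iff.mp h
  refine prod_eq_zero (mem_univ v) ?_
  revert hv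
  generalize hs : σ v = s
  generalize X v = b
  fin_cases s <;> cases b <;> simp [liftCoord, contr, hs]

theorem sum_liftCoord (θ : ℝ) (b : Bool) : ∑ s, liftCoord θ b s = 1 := by
  cases b <;> simp [Fin.sum_univ_three, liftCoord]

theorem sum_liftKernel {V : Type*} [Fintype V] [DecidableEq V] (θ : ℝ) (X : V → Bool) :
    ∑ σ, liftKernel θ X σ = 1 := by
  simp only [liftKernel]
  rw [← Fintype.piFinset_univ, ← prod_univ_sum]
  simp [sum_liftCoord]

theorem liftedDist_eq {V : Type*} [Fintype V] (f : (V → Bool) → ℝ) (θ : ℝ) (σ : V → Fin 3) :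
    liftedDist f θ σ = f (contr σ) * liftKernel θ (contr σ) σ := by
  rw [liftKernel_contr, liftedDist, mul_assoc]

theorem contr_update {V : Type*} [DecidableEq V] (σ : V → Fin 3) (v : V) (s : Fin 3) :
    contr (Function.update σ v s) =
      Function.update (contr σ) v (if s = 0 then false else true) := by
  funext w
  by_cases h : w = v
  · subst h; simp [contr]
  · simp [contr, h]

theorem liftKernel_update {V : Type*} [Fintype V] [DecidableEq V] (θ : ℝ) (X : V → Bool)
    (σ : V → Fin 3) (v : V) (b : Bool) (s : Fin 3) :
    liftKernel θ (Function.update X v b) (Function.update σ v s) =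
      liftCoord θ b s * ∏ w ∈ univ.erase v, liftCoord θ (X w) (σ w) := by
  rw [liftKernel, ← mul_prod_erase _ _ (mem_univ v)]
  congr 1
  · simp
  · exact prod_congr rfl fun w hw => by simp [ne_of_mem_erase hw]

/-- Summing a lifted function over the fibre of a coordinate. -/
theorem sum_liftedDist_update {V : Type*} [Fintype V] [DecidableEq V] (f : (V → Bool) → ℝ)
    (θ : ℝ) (σ : V → Fin 3) (v : V) :
    ∑ s, liftedDist f θ (Function.update σ v s) =
      (∑ b, f (Function.update (contr σ) v b)) *
        ∏ w ∈ univ.erase v, liftCoord θ (contr σ w) (σ w) := by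
  simp only [liftedDist_eq, contr_update, liftKernel_update, Fin.sum_univ_three, Fintype.sum_bool]
  simp [liftCoord]
  ring

theorem liftCoord_contr_ne_zero {V : Type*} {θ : ℝ} (hθ : θ ∈ Set.Ioo (0 : ℝ) 1)
    (σ : V → Fin 3) (v : V) : liftCoord θ (contr σ v) (σ v) ≠ 0 := by
  have h0 := hθ.1.ne'
  have h1 := (sub_pos.mpr hθ.2).ne'
  generalize h : σ v = s
  fin_cases s <;> simp [liftCoord, contr, h, h0, h1]

theorem sum_agree_off {V S : Type*} [Fintype V] [DecidableEq V] [Fintype S]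
    (g : (V → S) → ℝ) (τ : V → S) (v : V) :
    ∑ σ : V → S, (if ∀ w, w ≠ v → σ w = τ w then g σ else 0) =
      ∑ s, g (Function.update τ v s) := by
  rw [← sum_filter]
  symm
  refine sum_bij (fun s _ => Function.update τ v s) ?_ ?_ ?_ ?_
  · intro s _
    simp +contextual
  · intro a _ b _ h
    exact Function.update_injective τ v h
  · intro σ hσ
    refine ⟨σ v, mem_univ _, funext fun w => ?_⟩
    by_cases h : w = v
    · subst h; simp
    · simp [h, (mem_filter.mp hσ).2 w h]
  · simp

theorem stepDist_glauber {V S : Type*} [Fintype V] [DecidableEq V] [Fintype S]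
    (ν ρ : (V → S) → ℝ) (τ : V → S) :
    stepDist (glauber ν) ρ τ = (Fintype.card V : ℝ)⁻¹ *
      ∑ v, (∑ s, ρ (Function.update τ v s)) * (ν τ / ∑ s, ν (Function.update τ v s)) := by
  simp only [stepDist, glauber, mul_left_comm (ρ _), ← mul_sum]
  congr 1
  simp only [mul_sum, mul_ite, mul_zero]
  rw [sum_comm]
  refine sum_congr rfl fun v _ => ?_
  rw [sum_agree_off (fun σ => ρ σ * (ν τ / ∑ s, ν (Function.update σ v s)))]
  simp [sum_mul]

/-- One Glauber step commutes with lifting. -/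
theorem stepDist_glauber_liftedDist {V : Type*} [Fintype V] [DecidableEq V]
    (μ ρ : (V → Bool) → ℝ) {θ : ℝ} (hθ : θ ∈ Set.Ioo (0 : ℝ) 1) :
    stepDist (glauber (liftedDist μ θ)) (liftedDist ρ θ) =
      liftedDist (stepDist (glauber μ) ρ) θ := by
  funext τ
  rw [stepDist_glauber, liftedDist_eq (stepDist _ _), stepDist_glauber, mul_assoc, sum_mul]
  congr 1
  refine sum_congr rfl fun v _ => ?_
  have hne : ∏ w ∈ univ.erase v, liftCoord θ (contr τ w) (τ w) ≠ 0 :=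
    prod_ne_zero_iff.mpr fun w _ => liftCoord_contr_ne_zero hθ τ w
  rw [sum_liftedDist_update, sum_liftedDist_update, liftedDist_eq, ← mul_div_assoc, mul_right_comm,
    mul_div_mul_right _ _ hne]
  ring

theorem liftKernel_eq_liftedDist_delta {V : Type*} [Fintype V] [DecidableEq (V → Bool)] (θ : ℝ)
    (X : V → Bool) : liftKernel θ X = liftedDist (delta X) θ := by
  funext σ
  rw [liftedDist_eq, delta]
  split_ifs with h
  · rw [h, one_mul]
  · rw [zero_mul, liftKernel_eq_zero θ h]

theorem iterDist_glauber_liftedDist {V : Type*} [Fintype V] [DecidableEq V]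
    (μ ρ : (V → Bool) → ℝ) {θ : ℝ} (hθ : θ ∈ Set.Ioo (0 : ℝ) 1) (t : ℕ) :
    iterDist (glauber (liftedDist μ θ)) (liftedDist ρ θ) t =
      liftedDist (iterDist (glauber μ) ρ t) θ := by
  have h : Function.Semiconj (fun ρ => liftedDist ρ θ) (stepDist (glauber μ))
      (stepDist (glauber (liftedDist μ θ))) :=
    fun ρ => (stepDist_glauber_liftedDist μ ρ hθ).symm
  exact (h.iterate_right t ρ).symm

/-- The push-forward of a lift under `contr` is the original function. -/
theorem sum_liftedDist_contr_eq {V : Type*} [Fintype V] [DecidableEq V] (f : (V → Bool) → ℝ)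
    (θ : ℝ) (X : V → Bool) :
    ∑ σ, (if contr σ = X then liftedDist f θ σ else 0) = f X := by
  rw [← mul_one (f X), ← sum_liftKernel θ X, mul_sum]
  refine sum_congr rfl fun σ _ => ?_
  split_ifs with h
  · rw [liftedDist_eq, h]
  · rw [liftKernel_eq_zero θ h, mul_zero]

/-- **The lifted Glauber dynamics is the lift of the Glauber dynamics**: with `μ^(t)`
the law after `t` Glauber steps for `μ` from `1_V` and `π^(t)` the law after `t`
Glauber steps for the lifted distribution `π` from the law of `lift(1_V)`:
(a) `π^(t)` is the push-forward of `μ^(t)` under the lift kernel, i.e.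
`π^(t)(σ) = μ^(t)(contr σ) θ^{C₁(σ)} (1-θ)^{C_⋆(σ)}`, and
(b) the push-forward of `π^(t)` under `contr` equals `μ^(t)`. -/
theorem lifted_glauber_pushforward {V : Type*} [Fintype V] [DecidableEq V]
    (μ : (V → Bool) → ℝ) (hμ : IsDist μ) (hpos : 0 < μ (fun _ => true))
    (θ : ℝ) (hθ : θ ∈ Set.Ioo (0 : ℝ) 1) (t : ℕ) :
    (∀ σ : V → Fin 3,
        iterDist (glauber (liftedDist μ θ))
            (fun τ => liftKernel θ (fun _ => true) τ) t σ =
          iterDist (glauber μ) (delta (fun _ => true)) t (contr σ) *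
            θ ^ C1 σ * (1 - θ) ^ Cstar σ) ∧
      (∀ X : V → Bool,
        ∑ σ : V → Fin 3,
            (if contr σ = X then
              iterDist (glauber (liftedDist μ θ))
                (fun τ => liftKernel θ (fun _ => true) τ) t σ
            else 0) =
          iterDist (glauber μ) (delta (fun _ => true)) t X) := by
  have h : iterDist (glauber (liftedDist μ θ)) (fun τ => liftKernel θ (fun _ => true) τ) t =
      liftedDist (iterDist (glauber μ) (delta (fun _ => true)) t) θ := by
    rw [← iterDist_glauber_liftedDist μ _ hθ, ← liftKernel_eq_liftedDist_delta]
  rw [h]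
  exact ⟨fun _ => rfl, sum_liftedDist_contr_eq _ θ⟩
end

section
/- Let V be a finite set, θ ∈ (0,1), and let μ be a monotone system on {0,1}^V with lifted distribution π on {0,1,⋆}^V. Then the simulation chain P_s-GD is stochastically monotone on the support of π: for all σ, τ in the support of π with σ ≼ τ (coordinatewise with 0 < 1 < ⋆), the distribution P_s-GD(σ,·) is stochastically dominated by P_s-GD(τ,·). -/
open Finset

attribute [local instance] Classical.propDecidable

/-- `μ` is a monotone system: conditional marginals at a site are monotone in the
(feasible) pinning of the remaining sites. -/
def MonotoneSystem {V : Type*} [Fintype V] [DecidableEq V] (μ : (V → Bool) → ℝ) : Prop :=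
  ∀ (i : V) (σ τ : V → Bool), (∀ v, v ≠ i → σ v ≤ τ v) →
    0 < μ (Function.update σ i false) + μ (Function.update σ i true) →
    0 < μ (Function.update τ i false) + μ (Function.update τ i true) →
    μ (Function.update σ i true) /
        (μ (Function.update σ i false) + μ (Function.update σ i true)) ≤
      μ (Function.update τ i true) /
        (μ (Function.update τ i false) + μ (Function.update τ i true))

/-- The single-site update at `i` of the simulation chain: if `σ_i = ⋆` keep `σ`;
otherwise set `σ_i = 1` with probability
`θ·μ(contr(σ^{i←1})) / (μ(contr(σ^{i←0})) + θ·μ(contr(σ^{i←1})))` and `σ_i = 0` with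
the complementary probability. -/
noncomputable def psgdStep {V : Type*} [Fintype V] [DecidableEq V]
    (μ : (V → Bool) → ℝ) (θ : ℝ) (i : V) (σ τ : V → Fin 3) : ℝ :=
  if σ i = 2 then (if τ = σ then 1 else 0)
  else if τ = Function.update σ i 1 then
    θ * μ (contr (Function.update σ i 1)) /
      (μ (contr (Function.update σ i 0)) + θ * μ (contr (Function.update σ i 1)))
  else if τ = Function.update σ i 0 then
    μ (contr (Function.update σ i 0)) /
      (μ (contr (Function.update σ i 0)) + θ * μ (contr (Function.update σ i 1)))
  else 0

/-- The simulation chain `P_s-GD`: pick `i ∈ V` uniformly at random and perform the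
single-site simulation update at `i`. -/
noncomputable def PsGD {V : Type*} [Fintype V] [DecidableEq V]
    (μ : (V → Bool) → ℝ) (θ : ℝ) (σ τ : V → Fin 3) : ℝ :=
  (Fintype.card V : ℝ)⁻¹ * ∑ i : V, psgdStep μ θ i σ τ

theorem contr_update_zero {V : Type*} [DecidableEq V] (σ : V → Fin 3) (i : V) :
    contr (Function.update σ i 0) = Function.update (contr σ) i false := by
  ext v
  by_cases h : v = i
  · subst h; simp [contr]
  · simp [contr, h]

theorem contr_update_one {V : Type*} [DecidableEq V] (σ : V → Fin 3) (i : V) :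
    contr (Function.update σ i 1) = Function.update (contr σ) i true := by
  ext v
  by_cases h : v = i
  · subst h; simp [contr]
  · simp [contr, h]

theorem contr_mono {V : Type*} {σ τ : V → Fin 3} (h : σ ≤ τ) : contr σ ≤ contr τ := by
  intro v
  have hv := h v
  by_cases hτ : τ v = 0
  · have hσ : σ v = 0 := by rw [hτ] at hv; exact Fin.le_zero_iff.mp hv
    simp [contr, hσ, hτ]
  · simp only [contr, hτ, if_false]
    exact Bool.le_true _

theorem contr_pos_of_liftedDist_pos {V : Type*} [Fintype V] {μ : (V → Bool) → ℝ} {θ : ℝ}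
    (hθ : θ ∈ Set.Ioo (0 : ℝ) 1) {σ : V → Fin 3} (h : 0 < liftedDist μ θ σ) :
    0 < μ (contr σ) := by
  have h₁ : 0 < θ ^ C1 σ := pow_pos hθ.1 _
  have h₂ : 0 < (1 - θ) ^ Cstar σ := pow_pos (sub_pos.mpr hθ.2) _
  unfold liftedDist at h
  exact pos_of_mul_pos_left (pos_of_mul_pos_left h h₂.le) h₁.le

theorem update_false_pos_or_update_true_pos {V : Type*} [DecidableEq V] {μ : (V → Bool) → ℝ}
    {X : V → Bool} (h : 0 < μ X) (i : V) :
    0 < μ (Function.update X i false) ∨ 0 < μ (Function.update X i true) := by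
  cases hX : X i
  · left; rwa [← hX, Function.update_eq_self]
  · right; rwa [← hX, Function.update_eq_self]

/-- The expectation of `f` after one update at a coordinate that is not `⋆`. -/
theorem sum_psgdStep_mul_of_ne {V : Type*} [Fintype V] [DecidableEq V]
    (μ : (V → Bool) → ℝ) (θ : ℝ) (i : V) (σ : V → Fin 3) (h : σ i ≠ 2)
    (f : (V → Fin 3) → ℝ) :
    ∑ x, psgdStep μ θ i σ x * f x =
      (θ * μ (Function.update (contr σ) i true) * f (Function.update σ i 1) +
        μ (Function.update (contr σ) i false) * f (Function.update σ i 0)) /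
      (μ (Function.update (contr σ) i false) +
        θ * μ (Function.update (contr σ) i true)) := by
  have hne : Function.update σ i 0 ≠ Function.update σ i 1 := fun e => by
    simpa using congrFun e i
  rw [Fintype.sum_eq_add _ _ hne]
  · simp only [psgdStep, h, hne, if_false, if_true, contr_update_zero, contr_update_one]
    ring
  · rintro x ⟨h₀, h₁⟩
    simp [psgdStep, h, h₀, h₁]

theorem sum_psgdStep_mul_of_eq {V : Type*} [Fintype V] [DecidableEq V]
    (μ : (V → Bool) → ℝ) (θ : ℝ) (i : V) (σ : V → Fin 3) (h : σ i = 2)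
    (f : (V → Fin 3) → ℝ) :
    ∑ x, psgdStep μ θ i σ x * f x = f σ := by
  simp [psgdStep, h]

/-- Two-point averages are monotone in the values and in the odds of the larger value. -/
theorem two_point_average_le {θ a₀ a₁ b₀ b₁ u₀ u₁ v₀ v₁ : ℝ} (hθ : 0 ≤ θ)
    (ha₀ : 0 ≤ a₀) (ha₁ : 0 ≤ a₁) (ha : 0 < a₀ + θ * a₁) (hb : 0 < b₀ + θ * b₁)
    (hab : a₁ * b₀ ≤ b₁ * a₀) (h₀ : u₀ ≤ v₀) (h₁ : u₁ ≤ v₁) (hv : v₀ ≤ v₁) :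
    (θ * a₁ * u₁ + a₀ * u₀) / (a₀ + θ * a₁) ≤ (θ * b₁ * v₁ + b₀ * v₀) / (b₀ + θ * b₁) := by
  calc (θ * a₁ * u₁ + a₀ * u₀) / (a₀ + θ * a₁)
      ≤ (θ * a₁ * v₁ + a₀ * v₀) / (a₀ + θ * a₁) := by gcongr
    _ ≤ (θ * b₁ * v₁ + b₀ * v₀) / (b₀ + θ * b₁) := by
      rw [div_le_div_iff₀ ha hb]
      have := mul_nonneg (mul_nonneg hθ (sub_nonneg.mpr hab)) (sub_nonneg.mpr hv)
      linarith

theorem psgdStep_stochastically_monotone {V : Type*} [Fintype V] [DecidableEq V]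
    {μ : (V → Bool) → ℝ} (hμ : ∀ X, 0 ≤ μ X) (hmono : MonotoneSystem μ)
    {θ : ℝ} (hθ : 0 < θ) {σ τ : V → Fin 3} (hσ : 0 < μ (contr σ)) (hτ : 0 < μ (contr τ))
    (hle : σ ≤ τ) (i : V) :
    sd (psgdStep μ θ i σ) (psgdStep μ θ i τ) := by
  rintro f ⟨-, hf⟩
  have pos : ∀ ρ : V → Fin 3, 0 < μ (contr ρ) →
      ∀ c : ℝ, 0 < c → 0 < μ (Function.update (contr ρ) i false) +
        c * μ (Function.update (contr ρ) i true) := by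
    intro ρ hρ c hc
    rcases update_false_pos_or_update_true_pos hρ i with h | h
    · exact add_pos_of_pos_of_nonneg h (mul_nonneg hc.le (hμ _))
    · exact add_pos_of_nonneg_of_pos (hμ _) (mul_pos hc h)
  by_cases hτi : τ i = 2
  · rw [sum_psgdStep_mul_of_eq μ θ i τ hτi]
    by_cases hσi : σ i = 2
    · rw [sum_psgdStep_mul_of_eq μ θ i σ hσi]
      exact hf _ _ hle
    · rw [sum_psgdStep_mul_of_ne μ θ i σ hσi, div_le_iff₀ (pos σ hσ θ hθ)]
      have hup : ∀ c : Fin 3, f (Function.update σ i c) ≤ f τ := fun c =>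
        hf _ _ (update_le_iff.mpr
          ⟨by rw [hτi]; exact Fin.le_last c, fun j _ => hle j⟩)
      have h₁ := mul_le_mul_of_nonneg_left (hup 1)
        (mul_nonneg hθ.le (hμ (Function.update (contr σ) i true)))
      have h₀ := mul_le_mul_of_nonneg_left (hup 0) (hμ (Function.update (contr σ) i false))
      linarith
  · have hσi : σ i ≠ 2 := fun h => hτi (le_antisymm (Fin.le_last _) (h ▸ hle i))
    rw [sum_psgdStep_mul_of_ne μ θ i σ hσi, sum_psgdStep_mul_of_ne μ θ i τ hτi]
    have hup : ∀ c : Fin 3, f (Function.update σ i c) ≤ f (Function.update τ i c) := fun c =>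
      hf _ _ (update_le_update_iff.mpr ⟨le_rfl, fun j _ => hle j⟩)
    refine two_point_average_le hθ.le (hμ _) (hμ _) (pos σ hσ θ hθ) (pos τ hτ θ hθ) ?_
      (hup 0) (hup 1)
      (hf _ _ (update_le_update_iff.mpr ⟨Fin.zero_le _, fun _ _ => le_rfl⟩))
    have hσ' := pos σ hσ 1 one_pos
    have hτ' := pos τ hτ 1 one_pos
    rw [one_mul] at hσ' hτ'
    have h := hmono i (contr σ) (contr τ) (fun v _ => contr_mono hle v) hσ' hτ'
    rw [div_le_div_iff₀ hσ' hτ'] at h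
    linarith

theorem sum_PsGD_mul {V : Type*} [Fintype V] [DecidableEq V]
    (μ : (V → Bool) → ℝ) (θ : ℝ) (σ : V → Fin 3) (f : (V → Fin 3) → ℝ) :
    ∑ x, PsGD μ θ σ x * f x =
      (Fintype.card V : ℝ)⁻¹ * ∑ i, ∑ x, psgdStep μ θ i σ x * f x := by
  simp only [PsGD, mul_assoc, Finset.sum_mul, ← Finset.mul_sum]
  rw [Finset.sum_comm]

/-- **The simulation chain is stochastically monotone on the support of `π`**: for a
monotone system `μ` and all `σ ≼ τ` in the support of the lifted distribution `π`,
`P_s-GD(σ,·) ≼_sd P_s-GD(τ,·)`. -/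
theorem psgd_stochastically_monotone {V : Type*} [Fintype V] [DecidableEq V]
    (μ : (V → Bool) → ℝ) (hμ : IsDist μ) (hmono : MonotoneSystem μ)
    (θ : ℝ) (hθ : θ ∈ Set.Ioo (0 : ℝ) 1)
    (σ τ : V → Fin 3) (hσ : 0 < liftedDist μ θ σ) (hτ : 0 < liftedDist μ θ τ)
    (hle : σ ≤ τ) :
    sd (PsGD μ θ σ) (PsGD μ θ τ) := by
  intro f hf
  rw [sum_PsGD_mul, sum_PsGD_mul]
  refine mul_le_mul_of_nonneg_left (Finset.sum_le_sum fun i _ => ?_) (by positivity)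
  exact psgdStep_stochastically_monotone hμ.1 hmono hθ.1
    (contr_pos_of_liftedDist_pos hθ hσ) (contr_pos_of_liftedDist_pos hθ hτ) hle i f hf
end

section
/- Let V be a finite set, θ ∈ (0,1), μ a distribution on {0,1}^V, and π its lifted distribution on {0,1,⋆}^V. Then both the contract-lift chain P_cl and the simulation chain P_s-GD are reversible with respect to π: for all σ, τ in the support of π, π(σ)·P_cl(σ,τ) = π(τ)·P_cl(τ,σ) and π(σ)·P_s-GD(σ,τ) = π(τ)·P_s-GD(τ,σ). -/
open Finset

attribute [local instance] Classical.propDecidable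

/-- The contract-lift chain `P_cl(σ,τ) = 1[contr σ = contr τ]·θ^{C₁(τ)}·(1-θ)^{C_⋆(τ)}`. -/
noncomputable def Pcl {V : Type*} [Fintype V] (θ : ℝ) (σ τ : V → Fin 3) : ℝ :=
  if contr σ = contr τ then θ ^ C1 τ * (1 - θ) ^ Cstar τ else 0

theorem C1_update_one {V : Type*} [Fintype V] [DecidableEq V] (σ : V → Fin 3) (i : V)
    (h : σ i = 0) : C1 (Function.update σ i 1) = C1 σ + 1 := by
  have hi : i ∉ univ.filter (fun v => σ v = 1) := by simp [h]
  unfold C1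
  rw [← card_insert_of_notMem hi]
  congr 1
  ext v
  by_cases hv : v = i <;> simp [Function.update_apply, hv]

theorem Cstar_update_one {V : Type*} [Fintype V] [DecidableEq V] (σ : V → Fin 3) (i : V)
    (h : σ i = 0) : Cstar (Function.update σ i 1) = Cstar σ := by
  unfold Cstar
  congr 1
  ext v
  by_cases hv : v = i <;> simp [Function.update_apply, hv, h]

theorem psgdStep_eq_zero {V : Type*} [Fintype V] [DecidableEq V] (μ : (V → Bool) → ℝ) (θ : ℝ)
    (i : V) (σ τ : V → Fin 3) (hne : τ ≠ σ)
    (h : σ i = 2 ∨ τ i = 2 ∨ ∃ v, v ≠ i ∧ σ v ≠ τ v) : psgdStep μ θ i σ τ = 0 := by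
  unfold psgdStep
  by_cases hi : σ i = 2
  · simp [hi, hne]
  have key : ∀ c : Fin 3, c ≠ 2 → τ ≠ Function.update σ i c := by
    rintro c hc rfl
    rcases h with h | h | ⟨v, hv, h⟩
    · exact hi h
    · exact hc (by simpa using h)
    · simp [hv] at h
  simp [hi, key 0 (by decide), key 1 (by decide)]

theorem psgdStep_detailed_balance_update {V : Type*} [Fintype V] [DecidableEq V]
    (μ : (V → Bool) → ℝ) (θ : ℝ) (i : V) (σ : V → Fin 3) (h : σ i = 0) :
    liftedDist μ θ σ * psgdStep μ θ i σ (Function.update σ i 1) =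
      liftedDist μ θ (Function.update σ i 1) * psgdStep μ θ i (Function.update σ i 1) σ := by
  have h0 : Function.update σ i 0 = σ := by rw [← h, Function.update_eq_self]
  have hne : σ ≠ Function.update σ i 1 := fun e => by
    have := congrFun e i
    simp [h] at this
  simp only [psgdStep, liftedDist, Function.update_idem, Function.update_self, h0, h, hne,
    C1_update_one σ i h, Cstar_update_one σ i h, if_true, if_false,
    show (0 : Fin 3) ≠ 2 by decide, show (1 : Fin 3) ≠ 2 by decide]
  ring

theorem psgdStep_detailed_balance {V : Type*} [Fintype V] [DecidableEq V]
    (μ : (V → Bool) → ℝ) (θ : ℝ) (i : V) (σ τ : V → Fin 3) :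
    liftedDist μ θ σ * psgdStep μ θ i σ τ = liftedDist μ θ τ * psgdStep μ θ i τ σ := by
  by_cases hne : τ = σ
  · rw [hne]
  by_cases h : σ i = 2 ∨ τ i = 2 ∨ ∃ v, v ≠ i ∧ σ v ≠ τ v
  · have h' : τ i = 2 ∨ σ i = 2 ∨ ∃ v, v ≠ i ∧ τ v ≠ σ v := by
      simpa only [or_left_comm, ne_comm] using h
    rw [psgdStep_eq_zero μ θ i σ τ hne h, psgdStep_eq_zero μ θ i τ σ (Ne.symm hne) h']
    simp
  push Not at h
  obtain ⟨hσ, hτ, hoff⟩ := h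
  have hi : σ i ≠ τ i := fun e => hne <| funext fun v => by
    by_cases hv : v = i
    · rw [hv, e]
    · exact (hoff v hv).symm
  have hcases : (σ i = 0 ∧ τ i = 1) ∨ (τ i = 0 ∧ σ i = 1) := by omega
  rcases hcases with ⟨h0, h1⟩ | ⟨h0, h1⟩
  · have : τ = Function.update σ i 1 :=
      Function.eq_update_iff.2 ⟨h1, fun v hv => (hoff v hv).symm⟩
    rw [this]
    exact psgdStep_detailed_balance_update μ θ i σ h0
  · have : σ = Function.update τ i 1 := Function.eq_update_iff.2 ⟨h1, hoff⟩
    rw [this]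
    exact (psgdStep_detailed_balance_update μ θ i τ h0).symm

theorem Pcl_detailed_balance {V : Type*} [Fintype V] (μ : (V → Bool) → ℝ) (θ : ℝ)
    (σ τ : V → Fin 3) :
    liftedDist μ θ σ * Pcl θ σ τ = liftedDist μ θ τ * Pcl θ τ σ := by
  by_cases h : contr σ = contr τ
  · simp only [liftedDist, Pcl, h, if_true]
    ring
  · simp [Pcl, h, Ne.symm h]

theorem PsGD_detailed_balance {V : Type*} [Fintype V] [DecidableEq V]
    (μ : (V → Bool) → ℝ) (θ : ℝ) (σ τ : V → Fin 3) :
    liftedDist μ θ σ * PsGD μ θ σ τ = liftedDist μ θ τ * PsGD μ θ τ σ := by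
  simp only [PsGD, mul_left_comm (liftedDist μ θ _), mul_sum,
    psgdStep_detailed_balance μ θ _ σ τ]

/-- **Reversibility of the contract-lift and simulation chains with respect to the
lifted distribution** `π`: for all `σ, τ` in the support of `π`,
`π(σ)·P_cl(σ,τ) = π(τ)·P_cl(τ,σ)` and `π(σ)·P_s-GD(σ,τ) = π(τ)·P_s-GD(τ,σ)`. -/
theorem pcl_psgd_reversible {V : Type*} [Fintype V] [DecidableEq V]
    (μ : (V → Bool) → ℝ) (hμ : IsDist μ)
    (θ : ℝ) (hθ : θ ∈ Set.Ioo (0 : ℝ) 1)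
    (σ τ : V → Fin 3) (hσ : 0 < liftedDist μ θ σ) (hτ : 0 < liftedDist μ θ τ) :
    liftedDist μ θ σ * Pcl θ σ τ = liftedDist μ θ τ * Pcl θ τ σ ∧
      liftedDist μ θ σ * PsGD μ θ σ τ = liftedDist μ θ τ * PsGD μ θ τ σ := by
  exact ⟨Pcl_detailed_balance μ θ σ τ, PsGD_detailed_balance μ θ σ τ⟩
end

section
/- Let V be a finite set, θ ∈ (0,1), and let μ be a monotone system on {0,1}^V with lifted distribution π on {0,1,⋆}^V, whose support is Ω(π). Fix i ∈ V. Let P^i_π-GD be the single-site Glauber update at i for π (resample coordinate i from the conditional distribution of π given the other coordinates), and let P^i_s-GD be the single-site simulation update at i (if σ_i = ⋆, keep σ; otherwise set σ_i = 1 with probability θ·μ(contr(σ^{i←1})) / (μ(contr(σ^{i←0})) + θ·μ(contr(σ^{i←1}))) and σ_i = 0 with the complementary probability). Then P^i_π-GD ≼_mc P^i_s-GD: for every distribution ν on Ω(π) such that σ ↦ ν(σ)/π(σ) is increasing, νP^i_π-GD ≼_sd νP^i_s-GD. -/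
open Finset

attribute [local instance] Classical.propDecidable

/-- The single-site Glauber update at `i` for a distribution `ν` on `V → S`: resample
coordinate `i` from the conditional distribution of `ν` given the other coordinates. -/
noncomputable def glauberStep {V : Type*} [Fintype V] [DecidableEq V] {S : Type*}
    [Fintype S] (ν : (V → S) → ℝ) (i : V) (σ τ : V → S) : ℝ :=
  if ∀ w, w ≠ i → σ w = τ w then ν τ / ∑ s : S, ν (Function.update σ i s) else 0

/-- Averaging `f` over a three-point fibre against the full weights `p` is at most keeping the mass
`n₂` on the top point and averaging the rest over the two lower points, provided that `n / p` is
largest at the top point. -/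
lemma average_le_average_fixing_top {p₀ p₁ p₂ n₀ n₁ n₂ f₀ f₁ f₂ : ℝ}
    (hp₀ : 0 ≤ p₀) (hp₁ : 0 ≤ p₁) (hp₂ : 0 ≤ p₂) (hp : 0 < p₀ + p₁)
    (h₀ : n₀ * p₂ ≤ n₂ * p₀) (h₁ : n₁ * p₂ ≤ n₂ * p₁) (hf₀ : f₀ ≤ f₂) (hf₁ : f₁ ≤ f₂) :
    (n₀ + n₁ + n₂) * ((p₀ * f₀ + p₁ * f₁ + p₂ * f₂) / (p₀ + p₁ + p₂)) ≤
      (n₀ + n₁) * ((p₀ * f₀ + p₁ * f₁) / (p₀ + p₁)) + n₂ * f₂ := by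
  have hz : 0 < p₀ + p₁ + p₂ := by linarith
  have hmean : p₀ * f₀ + p₁ * f₁ ≤ (p₀ + p₁) * f₂ := by
    nlinarith [mul_le_mul_of_nonneg_left hf₀ hp₀, mul_le_mul_of_nonneg_left hf₁ hp₁]
  have key : 0 ≤ (n₂ * (p₀ + p₁) - (n₀ + n₁) * p₂) *
      ((p₀ + p₁) * f₂ - (p₀ * f₀ + p₁ * f₁)) :=
    mul_nonneg (by linarith) (by linarith)
  have hdiff : (n₀ + n₁) * ((p₀ * f₀ + p₁ * f₁) / (p₀ + p₁)) + n₂ * f₂ -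
      (n₀ + n₁ + n₂) * ((p₀ * f₀ + p₁ * f₁ + p₂ * f₂) / (p₀ + p₁ + p₂)) =
      ((n₂ * (p₀ + p₁) - (n₀ + n₁) * p₂) * ((p₀ + p₁) * f₂ - (p₀ * f₀ + p₁ * f₁))) /
        ((p₀ + p₁) * (p₀ + p₁ + p₂)) := by
    field_simp
    ring
  have := div_nonneg key (mul_pos hp hz).le
  linarith

lemma contr_update_two {V : Type*} [DecidableEq V] (i : V) (σ : V → Fin 3) :
    contr (Function.update σ i 2) = contr (Function.update σ i 1) := by
  ext v
  by_cases hv : v = i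
  · subst hv; simp [contr]
  · simp [contr, hv]

lemma liftedDist_eq_mul_prod {V : Type*} [Fintype V] (μ : (V → Bool) → ℝ) (θ : ℝ)
    (σ : V → Fin 3) : liftedDist μ θ σ = μ (contr σ) * ∏ v, ![1, θ, 1 - θ] (σ v) := by
  have hw (x : Fin 3) : ![1, θ, 1 - θ] x =
      (if x = 1 then θ else 1) * (if x = 2 then 1 - θ else 1) := by
    fin_cases x <;> simp
  simp only [liftedDist, C1, Cstar, hw, Finset.prod_mul_distrib, Finset.prod_ite,
    Finset.prod_const, one_pow, mul_one, mul_assoc]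

section SingleSite

variable {V : Type*} [Fintype V] [DecidableEq V]

lemma sum_eq_sum_update {S : Type*} [Fintype S] (i : V) (σ : V → S) (F : (V → S) → ℝ)
    (hF : ∀ τ, (¬ ∀ w, w ≠ i → σ w = τ w) → F τ = 0) :
    ∑ τ, F τ = ∑ s, F (Function.update σ i s) := by
  rw [← Finset.sum_image (f := F) (g := fun s => Function.update σ i s)
    (fun s _ t _ h => Function.update_injective σ i h)]
  refine (Finset.sum_subset (Finset.subset_univ _) fun τ _ hτ => hF τ fun h => hτ ?_).symm
  refine Finset.mem_image.2 ⟨τ i, Finset.mem_univ _, ?_⟩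
  ext w
  by_cases hw : w = i
  · subst hw; simp
  · simp [hw, h w hw]

lemma sum_le_sum_of_sum_update_le {S : Type*} [Fintype S] (i : V) {F G : (V → S) → ℝ}
    (h : ∀ σ, ∑ s, F (Function.update σ i s) ≤ ∑ s, G (Function.update σ i s)) :
    ∑ σ, F σ ≤ ∑ σ, G σ := by
  have hsplit (H : (V → S) → ℝ) : ∑ σ, H σ =
      ∑ ρ : {j // j ≠ i} → S, ∑ s, H ((Equiv.funSplitAt i S).symm (s, ρ)) := by
    rw [← (Equiv.funSplitAt i S).symm.sum_comp, Fintype.sum_prod_type, Finset.sum_comm]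
  rw [hsplit F, hsplit G]
  refine Finset.sum_le_sum fun ρ _ => ?_
  rcases isEmpty_or_nonempty S with _ | ⟨⟨s₀⟩⟩
  · simp
  have hupdate (s : S) : (Equiv.funSplitAt i S).symm (s, ρ) =
      Function.update ((Equiv.funSplitAt i S).symm (s₀, ρ)) i s := by
    ext w
    by_cases hw : w = i
    · subst hw; simp [Equiv.funSplitAt, Equiv.piSplitAt]
    · simp [Equiv.funSplitAt, Equiv.piSplitAt, hw]
  simpa only [← hupdate] using h ((Equiv.funSplitAt i S).symm (s₀, ρ))

/-- Resampling at `i` from weights averages `f` over the fibre of `σ` along the coordinate `i`. -/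
lemma sum_glauberStep_mul {S : Type*} [Fintype S] (p : (V → S) → ℝ) (i : V) (σ : V → S)
    (f : (V → S) → ℝ) :
    ∑ τ, glauberStep p i σ τ * f τ =
      (∑ s, p (Function.update σ i s) * f (Function.update σ i s)) /
        ∑ s, p (Function.update σ i s) := by
  rw [sum_eq_sum_update i σ _ fun τ h => by simp only [glauberStep, if_neg h, zero_mul],
    Finset.sum_div]
  refine Finset.sum_congr rfl fun s _ => ?_
  rw [glauberStep, if_pos fun w hw => by simp [hw]]
  ring

lemma sum_psgdStep_mul_of_eq_two (μ : (V → Bool) → ℝ) (θ : ℝ) (i : V) {σ : V → Fin 3}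
    (hσ : σ i = 2) (f : (V → Fin 3) → ℝ) : ∑ τ, psgdStep μ θ i σ τ * f τ = f σ := by
  simp [psgdStep, hσ]

lemma sum_psgdStep_mul_of_ne_two (μ : (V → Bool) → ℝ) (θ : ℝ) (i : V) {σ : V → Fin 3}
    (hσ : σ i ≠ 2) (f : (V → Fin 3) → ℝ) :
    ∑ τ, psgdStep μ θ i σ τ * f τ =
      (μ (contr (Function.update σ i 0)) * f (Function.update σ i 0) +
          θ * μ (contr (Function.update σ i 1)) * f (Function.update σ i 1)) /
        (μ (contr (Function.update σ i 0)) + θ * μ (contr (Function.update σ i 1))) := by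
  have hzero : ∀ τ, (¬ ∀ w, w ≠ i → σ w = τ w) → psgdStep μ θ i σ τ * f τ = 0 := by
    intro τ h
    have hne (s : Fin 3) : τ ≠ Function.update σ i s := by
      rintro rfl
      exact h fun w hw => by simp [hw]
    simp [psgdStep, hσ, hne]
  rw [sum_eq_sum_update i σ _ hzero, Fin.sum_univ_three]
  have hinj (s t : Fin 3) : Function.update σ i s = Function.update σ i t ↔ s = t :=
    (Function.update_injective σ i).eq_iff
  simp only [psgdStep, hσ, if_false, hinj]
  simp
  ring

lemma liftedDist_update (μ : (V → Bool) → ℝ) (θ : ℝ) (i : V) (σ : V → Fin 3) (s : Fin 3) :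
    liftedDist μ θ (Function.update σ i s) =
      (∏ v ∈ univ \ {i}, ![1, θ, 1 - θ] (σ v)) *
        (μ (contr (Function.update σ i s)) * ![1, θ, 1 - θ] s) := by
  have hprod : ∏ v, ![1, θ, 1 - θ] (Function.update σ i s v) =
      ![1, θ, 1 - θ] s * ∏ v ∈ univ \ {i}, ![1, θ, 1 - θ] (σ v) := by
    have := Finset.prod_update_of_mem (Finset.mem_univ i) (fun v => ![1, θ, 1 - θ] (σ v))
      (![1, θ, 1 - θ] s)
    rw [← this]
    refine Finset.prod_congr rfl fun v _ => ?_
    by_cases hv : v = i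
    · subst hv; simp
    · simp [hv]
  rw [liftedDist_eq_mul_prod, hprod]
  ring

end SingleSite

/-- **Single-site comparison of the Glauber and simulation updates**:
`P^i_π-GD ≼_mc P^i_s-GD`, i.e. for every distribution `ν` on the support of the lifted
distribution `π` with `ν/π` increasing on the support, `νP^i_π-GD ≼_sd νP^i_s-GD`. -/
theorem single_site_comparison {V : Type*} [Fintype V] [DecidableEq V]
    (μ : (V → Bool) → ℝ) (hμ : IsDist μ) (hmono : MonotoneSystem μ)
    (θ : ℝ) (hθ : θ ∈ Set.Ioo (0 : ℝ) 1) (i : V)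
    (ν : (V → Fin 3) → ℝ) (hν : IsDist ν)
    (hsupp : ∀ σ, liftedDist μ θ σ = 0 → ν σ = 0)
    (hincr : ∀ σ τ : V → Fin 3, 0 < liftedDist μ θ σ → 0 < liftedDist μ θ τ → σ ≤ τ →
      ν σ / liftedDist μ θ σ ≤ ν τ / liftedDist μ θ τ) :
    sd (fun τ => ∑ σ, ν σ * glauberStep (liftedDist μ θ) i σ τ)
      (fun τ => ∑ σ, ν σ * psgdStep μ θ i σ τ) := by
  intro f hf
  obtain ⟨hθ₀, hθ₁⟩ := hθ
  have hw (x : Fin 3) : 0 < ![1, θ, 1 - θ] x := by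
    fin_cases x <;> simp [hθ₀, hθ₁]
  have hπ (σ : V → Fin 3) : 0 ≤ liftedDist μ θ σ := by
    rw [liftedDist_eq_mul_prod]
    exact mul_nonneg (hμ.1 _) (Finset.prod_nonneg fun v _ => (hw _).le)
  have hcross (σ τ : V → Fin 3) (h : σ ≤ τ) :
      ν σ * liftedDist μ θ τ ≤ ν τ * liftedDist μ θ σ := by
    rcases (hπ σ).eq_or_lt with hσ | hσ
    · simp [← hσ, hsupp σ hσ.symm]
    rcases (hπ τ).eq_or_lt with hτ | hτ
    · simp [← hτ, hsupp τ hτ.symm]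
    exact (div_le_div_iff₀ hσ hτ).1 (hincr σ τ hσ hτ h)
  have hswap (K : (V → Fin 3) → (V → Fin 3) → ℝ) :
      ∑ τ, (∑ σ, ν σ * K σ τ) * f τ = ∑ σ, ν σ * ∑ τ, K σ τ * f τ := by
    simp only [Finset.sum_mul, Finset.mul_sum, mul_assoc]
    exact Finset.sum_comm
  rw [hswap, hswap]
  refine sum_le_sum_of_sum_update_le i fun σ => ?_
  simp only [sum_glauberStep_mul, Function.update_idem, Fin.sum_univ_three]
  rw [sum_psgdStep_mul_of_ne_two μ θ i (σ := Function.update σ i 0) (by simp),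
    sum_psgdStep_mul_of_ne_two μ θ i (σ := Function.update σ i 1) (by simp),
    sum_psgdStep_mul_of_eq_two μ θ i (σ := Function.update σ i 2) (by simp)]
  simp only [Function.update_idem]
  have hle (s t : Fin 3) (h : s ≤ t) : Function.update σ i s ≤ Function.update σ i t :=
    update_le_update_iff'.2 h
  set W := ∏ v ∈ univ \ {i}, ![1, θ, 1 - θ] (σ v) with hW
  have hWpos : 0 < W := Finset.prod_pos fun v _ => hw _
  have hπ₀ : liftedDist μ θ (Function.update σ i 0) =
      W * μ (contr (Function.update σ i 0)) := by
    simp [liftedDist_update, hW]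
  have hπ₁ : liftedDist μ θ (Function.update σ i 1) =
      W * (θ * μ (contr (Function.update σ i 1))) := by
    simp [liftedDist_update, hW, mul_comm θ]
  have hπ₂ : liftedDist μ θ (Function.update σ i 2) =
      W * (μ (contr (Function.update σ i 1)) * (1 - θ)) := by
    simp [liftedDist_update, hW, contr_update_two]
  have hratio : (μ (contr (Function.update σ i 0)) * f (Function.update σ i 0) +
        θ * μ (contr (Function.update σ i 1)) * f (Function.update σ i 1)) /
      (μ (contr (Function.update σ i 0)) + θ * μ (contr (Function.update σ i 1))) =
      (liftedDist μ θ (Function.update σ i 0) * f (Function.update σ i 0) +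
        liftedDist μ θ (Function.update σ i 1) * f (Function.update σ i 1)) /
      (liftedDist μ θ (Function.update σ i 0) + liftedDist μ θ (Function.update σ i 1)) := by
    rw [hπ₀, hπ₁, ← mul_add, mul_assoc W, mul_assoc W, ← mul_add, mul_div_mul_left _ _ hWpos.ne']
  rw [hratio, ← add_mul, ← add_mul, ← add_mul]
  rcases (add_nonneg (hπ (Function.update σ i 0)) (hπ (Function.update σ i 1))).eq_or_lt
    with hp | hp
  · have h₀ : liftedDist μ θ (Function.update σ i 0) = 0 := by
      linarith [hπ (Function.update σ i 0), hπ (Function.update σ i 1)]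
    have h₁ : liftedDist μ θ (Function.update σ i 1) = 0 := by
      linarith [hπ (Function.update σ i 0), hπ (Function.update σ i 1)]
    have h₂ : liftedDist μ θ (Function.update σ i 2) = 0 := by
      have : μ (contr (Function.update σ i 1)) = 0 := by
        simpa [hπ₁, hWpos.ne', hθ₀.ne'] using h₁
      simp [hπ₂, this]
    simp [hsupp _ h₀, hsupp _ h₁, hsupp _ h₂]
  · exact average_le_average_fixing_top (hπ _) (hπ _) (hπ _) hp
      (hcross _ _ (hle 0 2 (by decide))) (hcross _ _ (hle 1 2 (by decide)))
      (hf.2 _ _ (hle 0 2 (by decide))) (hf.2 _ _ (hle 1 2 (by decide)))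
end
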